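/- Let P be a unital subsemigroup of a group G. For every nonempty constructible ideal x ∈ J, one may choose p_1, q_1, ..., p_n, q_n ∈ P such that x = q_n⁻¹p_n ⋯ q_1⁻¹p_1 P and p_1⁻¹q_1 ⋯ p_n⁻¹q_n = e in G. -/

import Mathlib

/-- `q⁻¹(pZ)` computed inside the unital subsemigroup `P` of the group `G`. -/
def subStep {G : Type*} [Group G] (P : Submonoid G) (pq : G × G) (Z : Set G) : Set G :=
  {y | y ∈ P ∧ pq.2 * y ∈ (pq.1 * ·) '' Z}

/-- `qₙ⁻¹pₙ ⋯ q₁⁻¹p₁ Z` for `L = [(p₁,q₁), …, (pₙ,qₙ)]`, computed inside `P`. -/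
def subWord {G : Type*} [Group G] (P : Submonoid G) (L : List (G × G)) (Z : Set G) : Set G :=
  L.foldl (fun Z pq => subStep P pq Z) Z

/-- The family of constructible right ideals of `P`. -/
def Constructible {G : Type*} [Group G] (P : Submonoid G) : Set (Set G) :=
  {S | ∃ L : List (G × G), (∀ pq ∈ L, pq.1 ∈ P ∧ pq.2 ∈ P) ∧ S = subWord P L (P : Set G)}
    ∪ {∅}

theorem subStep_inter {G : Type*} [Group G] (P : Submonoid G) (a : G × G) (A B : Set G) :
    subStep P a (A ∩ B) = subStep P a A ∩ subStep P a B := by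
  ext y
  constructor
  · rintro ⟨hy, z, ⟨h1, h2⟩, hz⟩
    exact ⟨⟨hy, z, h1, hz⟩, ⟨hy, z, h2, hz⟩⟩
  · rintro ⟨⟨hy, z, h1, hz⟩, ⟨_, w, h2, hw⟩⟩
    have h : z = w := mul_left_cancel (hz.trans hw.symm)
    subst h
    exact ⟨hy, z, ⟨h1, h2⟩, hz⟩

theorem subWord_inter {G : Type*} [Group G] (P : Submonoid G) (L : List (G × G)) :
    ∀ A B : Set G, subWord P L (A ∩ B) = subWord P L A ∩ subWord P L B := by
  induction L with
  | nil => intro A B; rfl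
  | cons a L ih =>
    intro A B
    change subWord P L (subStep P a (A ∩ B)) = _
    rw [subStep_inter, ih]; rfl

theorem subStep_sub {G : Type*} [Group G] (P : Submonoid G) (a : G × G) (A : Set G) :
    subStep P a A ⊆ P := fun _ h => h.1

theorem subWord_sub {G : Type*} [Group G] (P : Submonoid G) (L : List (G × G)) :
    ∀ A : Set G, A ⊆ P → subWord P L A ⊆ P := by
  induction L with
  | nil => intro A h; exact h
  | cons a L ih => intro A _; exact ih _ (subStep_sub P a A)

theorem subStep_swap {G : Type*} [Group G] (P : Submonoid G) (a : G × G) (W : Set G)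
    (hW : W ⊆ P) : subStep P a (subStep P a.swap W) = W ∩ subStep P a P := by
  ext y
  constructor
  · rintro ⟨hy, z, ⟨h1, w, hw, h2⟩, hz⟩
    have h : w = y := mul_left_cancel (h2.trans hz)
    subst h
    exact ⟨hw, hy, z, h1, hz⟩
  · rintro ⟨h, hy, z, h1, hz⟩
    exact ⟨hy, z, ⟨h1, y, h, hz.symm⟩, hz⟩

theorem subWord_rev {G : Type*} [Group G] (P : Submonoid G) (L : List (G × G)) (Z : Set G)
    (hZ : Z ⊆ P) :
    subWord P L (subWord P (L.map Prod.swap).reverse Z) = Z ∩ subWord P L P := by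
  induction L with
  | nil => exact (Set.inter_eq_left.2 hZ).symm
  | cons a L ih =>
    have e : subWord P ((a :: L).map Prod.swap).reverse Z
        = subStep P a.swap (subWord P (L.map Prod.swap).reverse Z) := by
      simp [subWord, List.foldl_append]
    rw [e]
    change subWord P L (subStep P a _) = Z ∩ subWord P L (subStep P a P)
    rw [subStep_swap P a _ (subWord_sub P _ Z hZ), subWord_inter, ih, Set.inter_assoc,
      ← subWord_inter, Set.inter_eq_right.2 (subStep_sub P a P)]

theorem prod_rev {G : Type*} [Group G] (L : List (G × G)) :
    (((L.map Prod.swap).reverse).map fun pq => pq.1⁻¹ * pq.2).prod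
      = ((L.map fun pq => pq.1⁻¹ * pq.2).prod)⁻¹ := by
  induction L with
  | nil => simp
  | cons a L ih =>
    rw [List.map_cons, List.reverse_cons, List.map_append, List.prod_append, ih]
    simp

/-- Every nonempty constructible ideal `x` admits a presentation
`x = qₙ⁻¹pₙ ⋯ q₁⁻¹p₁ P` with `p₁⁻¹q₁ ⋯ pₙ⁻¹qₙ = e` in `G`. -/
theorem stmt5 {G : Type*} [Group G] (P : Submonoid G)
    (x : Set G) (hx : x ∈ Constructible P) (hne : x.Nonempty) :
    ∃ L : List (G × G), (∀ pq ∈ L, pq.1 ∈ P ∧ pq.2 ∈ P) ∧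
      (L.map fun pq => pq.1⁻¹ * pq.2).prod = 1 ∧
      x = subWord P L (P : Set G) := by
  rcases hx with ⟨L, hL, rfl⟩ | h
  · refine ⟨(L.map Prod.swap).reverse ++ L, ?_, ?_, ?_⟩
    · intro pq h
      rcases List.mem_append.1 h with h | h
      · obtain ⟨a, ha, rfl⟩ := List.mem_map.1 (List.mem_reverse.1 h)
        exact ⟨(hL a ha).2, (hL a ha).1⟩
      · exact hL pq h
    · rw [List.map_append, List.prod_append, prod_rev, inv_mul_cancel]
    · have e : subWord P ((L.map Prod.swap).reverse ++ L) (P : Set G)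
          = subWord P L (subWord P (L.map Prod.swap).reverse P) := by
        simp [subWord, List.foldl_append]
      rw [e, subWord_rev P L P subset_rfl,
        Set.inter_eq_right.2 (subWord_sub P L P subset_rfl)]
  · rw [Set.mem_singleton_iff.1 h] at hne
    exact absurd hne Set.not_nonempty_empty
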